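/- Let ρ be a compatible sl₂(ℂ)-representation on A and ρ_ε a compatible infinitesimal deformation with L_ε = L + εv. Let φ̃ : L^jP^{n−2j} → ⊕_{i≠j} L^iP^{n−2i} denote the map sending x to the projection of φ(x) onto ⊕_{i≠j} L^iP^{n−2i} with respect to the primitive decomposition A^n = ⊕_{i≥0} L^iP^{n−2i} (this map measures the first-order variation of the subspace L^jP^{n−2j} ⊂ A^n under the deformation). Then for every α ∈ P^{n−2j}: φ̃(L^j(α)) = (N−n+j+1)L^{j+1}(Q_v²(α)) − jL^{j−1}(Q_v⁰(α)) (the last term being absent for j = 0). -/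

import Mathlib

/-- A compatible `sl₂(ℂ)`-representation on a graded algebra `A = ⊕ₙ Aⁿ` (graded pieces
`𝒜 n`, indexed by `ℤ`): the generators `L`, `Λ`, `B` satisfy the `sl₂` commutation
relations, `L` and `Λ` are homogeneous of degree `2` and `-2`, `B` acts on `Aⁿ` as
multiplication by `N - n`, and `L(αβ) = L(α)β`. -/
structure CompatSL2 (N : ℕ) (A : Type) [Ring A] [Algebra ℂ A]
    (𝒜 : ℤ → Submodule ℂ A) : Type where
  L : Module.End ℂ A
  Lam : Module.End ℂ A
  B : Module.End ℂ A
  comm_LamL : Lam * L - L * Lam = B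
  comm_BL : B * L - L * B = (-2 : ℂ) • L
  comm_BLam : B * Lam - Lam * B = (2 : ℂ) • Lam
  L_deg : ∀ (n : ℤ), ∀ x ∈ 𝒜 n, L x ∈ 𝒜 (n + 2)
  Lam_deg : ∀ (n : ℤ), ∀ x ∈ 𝒜 n, Lam x ∈ 𝒜 (n - 2)
  B_weight : ∀ (n : ℤ), ∀ x ∈ 𝒜 n, B x = ((N : ℤ) - n) • x
  L_mul : ∀ a b : A, L (a * b) = L a * b

/-- The endomorphism `f + ε g` of `A[ε] = A ⊗ ℂ[ε]/(ε²)`, identified with `A × A` via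
`a + ε b ↔ (a, b)`; it sends `a + εb` to `f a + ε (f b + g a)`. -/
def deform {A : Type} [Ring A] [Algebra ℂ A] (f g : Module.End ℂ A) :
    Module.End ℂ (A × A) :=
  f.prodMap f + (LinearMap.inr ℂ A A) ∘ₗ g ∘ₗ (LinearMap.fst ℂ A A)

/-- The deformed Lefschetz operator `L_ε = L + ε v`, where `v` acts by (right)
multiplication. -/
def Leps {A : Type} [Ring A] [Algebra ℂ A] (L : Module.End ℂ A) (v : A) :
    Module.End ℂ (A × A) :=
  deform L (LinearMap.mulRight ℂ v)

/-- The deformed dual Lefschetz operator `Λ_ε = Λ + ε [Λ, φ]`. -/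
def Lameps {A : Type} [Ring A] [Algebra ℂ A] (Lam φ : Module.End ℂ A) :
    Module.End ℂ (A × A) :=
  deform Lam (Lam * φ - φ * Lam)

namespace CompatSL2

variable {N : ℕ} {A : Type} [Ring A] [Algebra ℂ A] {𝒜 : ℤ → Submodule ℂ A}

theorem L_pow_mem (S : CompatSL2 N A 𝒜) {p : ℤ} {x : A} (hx : x ∈ 𝒜 p) (k : ℕ) :
    (S.L ^ k) x ∈ 𝒜 (p + 2 * k) := by
  induction k with
  | zero => simpa using hx
  | succ k ih =>
    rw [pow_succ', Module.End.mul_apply]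
    convert S.L_deg _ _ ih using 2
    push_cast
    ring

theorem Lam_L (S : CompatSL2 N A 𝒜) {p : ℤ} {x : A} (hx : x ∈ 𝒜 p) :
    S.Lam (S.L x) = S.L (S.Lam x) + ((N : ℂ) - p) • x := by
  have h := congrArg (fun f : Module.End ℂ A => f x) S.comm_LamL
  simp only [LinearMap.sub_apply, Module.End.mul_apply, S.B_weight p x hx] at h
  rw [← Int.cast_smul_eq_zsmul ℂ] at h
  push_cast at h
  rw [← h]
  abel

theorem Lam_L_pow_succ (S : CompatSL2 N A 𝒜) {p : ℤ} {x : A} (hx : x ∈ 𝒜 p) (k : ℕ) :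
    S.Lam ((S.L ^ (k + 1)) x) =
      (S.L ^ (k + 1)) (S.Lam x) + (((k : ℂ) + 1) * ((N : ℂ) - p - k)) • (S.L ^ k) x := by
  induction k with
  | zero => simpa using S.Lam_L hx
  | succ k ih =>
    rw [pow_succ' S.L (k + 1), Module.End.mul_apply, Module.End.mul_apply,
      S.Lam_L (S.L_pow_mem hx (k + 1)), ih, map_add, map_smul, add_assoc,
      ← Module.End.mul_apply S.L (S.L ^ k), ← pow_succ', ← add_smul]
    congr 2
    push_cast
    ring

/-- One step down a primitive string, away from its top degree. -/
theorem L_pow_eq_zero_of_succ (S : CompatSL2 N A 𝒜) {p : ℤ} {x : A} (hx : x ∈ 𝒜 p)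
    (hxp : S.Lam x = 0) {k : ℕ} (hk : p + k ≠ N) (h : (S.L ^ (k + 1)) x = 0) :
    (S.L ^ k) x = 0 := by
  have h1 := S.Lam_L_pow_succ hx k
  rw [h, hxp, map_zero, map_zero, zero_add] at h1
  refine (smul_eq_zero.mp h1.symm).resolve_left (mul_ne_zero (by exact_mod_cast k.succ_ne_zero) ?_)
  intro h2
  apply hk
  have h3 : ((N : ℤ) : ℂ) - p - (k : ℤ) = 0 := by exact_mod_cast h2
  have h4 : (N : ℤ) - p - k = 0 := by exact_mod_cast h3
  omega

theorem L_pow_primitive_eq_zero (S : CompatSL2 N A 𝒜)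
    (hbound : ∀ n : ℤ, (n < 0 ∨ 2 * (N : ℤ) < n) → 𝒜 n = ⊥) {p : ℤ} {x : A}
    (hx : x ∈ 𝒜 p) (hxp : S.Lam x = 0) {r : ℕ} (hr : (N : ℤ) < p + r) :
    (S.L ^ r) x = 0 := by
  have top : (S.L ^ (r + (2 * N + p.natAbs + 1))) x = 0 := by
    have h := S.L_pow_mem hx (r + (2 * N + p.natAbs + 1))
    rw [hbound _ (Or.inr (by omega))] at h
    simpa using h
  generalize 2 * N + p.natAbs + 1 = d at top
  induction d with
  | zero => exact top
  | succ d ih => exact ih (S.L_pow_eq_zero_of_succ hx hxp (by push_cast; omega) top)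

/-- Since `Λ` commutes with `L ^ (N - p + 1)` on the piece of degree `p`, it carries the kernel
of that power into the kernel of `L ^ (N - (p - 2))`. -/
theorem L_pow_Lam_eq_zero (S : CompatSL2 N A 𝒜) {p : ℤ} {x : A} (hx : x ∈ 𝒜 p) {s : ℕ}
    (hs : p + s = N) (h : (S.L ^ (s + 1)) x = 0) : (S.L ^ (s + 2)) (S.Lam x) = 0 := by
  have h1 := S.Lam_L_pow_succ hx s
  have h2 : (N : ℂ) - p - s = 0 := by
    have : ((N : ℤ) : ℂ) = ((p + s : ℤ) : ℂ) := by rw [hs]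
    push_cast at this
    rw [this]
    ring
  rw [h, map_zero, h2, mul_zero, zero_smul, add_zero] at h1
  rw [pow_succ', Module.End.mul_apply, ← h1, map_zero]

/-- The injectivity half of the hard Lefschetz property. -/
theorem eq_zero_of_L_pow_eq_zero (S : CompatSL2 N A 𝒜)
    (hbound : ∀ n : ℤ, (n < 0 ∨ 2 * (N : ℤ) < n) → 𝒜 n = ⊥) {p : ℤ} {x : A}
    (hx : x ∈ 𝒜 p) {s : ℕ} (hs : p + s = N) (h : (S.L ^ s) x = 0) : x = 0 := by
  obtain ⟨d, hd⟩ : ∃ d : ℕ, p < d := ⟨p.natAbs + 1, by omega⟩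
  induction d generalizing p x s with
  | zero =>
    rw [hbound p (Or.inl (by simpa using hd))] at hx
    simpa using hx
  | succ d ih =>
    have hΛ : S.Lam x = 0 := by
      refine ih (s := s + 2) (S.Lam_deg p x hx) (by push_cast; omega) ?_ (by omega)
      refine S.L_pow_Lam_eq_zero hx hs ?_
      rw [pow_succ', Module.End.mul_apply, h, map_zero]
    have descend : ∀ k : ℕ, k ≤ s → (S.L ^ k) x = 0 → x = 0 := by
      intro k
      induction k with
      | zero => exact fun _ h0 => by simpa using h0
      | succ k ihk =>
        exact fun hk h0 => ihk (by omega) (S.L_pow_eq_zero_of_succ hx hΛ (by omega) h0)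
    exact descend s le_rfl h

theorem Lam_eq_zero_of_L_pow_eq_zero (S : CompatSL2 N A 𝒜)
    (hbound : ∀ n : ℤ, (n < 0 ∨ 2 * (N : ℤ) < n) → 𝒜 n = ⊥) {p : ℤ} {x : A}
    (hx : x ∈ 𝒜 p) {s : ℕ} (hs : p + s = N) (h : (S.L ^ (s + 1)) x = 0) : S.Lam x = 0 :=
  S.eq_zero_of_L_pow_eq_zero hbound (S.Lam_deg p x hx) (s := s + 2) (by push_cast; omega)
    (S.L_pow_Lam_eq_zero hx hs h)

theorem L_pow_mul (S : CompatSL2 N A 𝒜) (k : ℕ) (a b : A) :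
    (S.L ^ k) (a * b) = (S.L ^ k) a * b := by
  induction k with
  | zero => simp
  | succ k ih => rw [pow_succ', Module.End.mul_apply, Module.End.mul_apply, ih, S.L_mul]

theorem apply_L_pow (S : CompatSL2 N A 𝒜) {φ : Module.End ℂ A} {v : A}
    (hφL : S.L * φ - φ * S.L = LinearMap.mulRight ℂ v) (k : ℕ) (x : A) :
    φ ((S.L ^ k) x) = (S.L ^ k) (φ x) - (k : ℂ) • (S.L ^ (k - 1)) (x * v) := by
  induction k with
  | zero => simp
  | succ k ih =>
    have h := congrArg (fun f : Module.End ℂ A => f ((S.L ^ k) x)) hφL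
    simp only [LinearMap.sub_apply, Module.End.mul_apply, LinearMap.mulRight_apply,
      ← S.L_pow_mul] at h
    have hk : (k : ℂ) • S.L ((S.L ^ (k - 1)) (x * v)) = (k : ℂ) • (S.L ^ k) (x * v) := by
      cases k with
      | zero => simp
      | succ k => rw [pow_succ' S.L k]; rfl
    rw [sub_eq_iff_eq_add, ← sub_eq_iff_eq_add'] at h
    rw [pow_succ', Module.End.mul_apply, Module.End.mul_apply, ← h, ih, map_sub, map_smul, hk,
      Nat.add_sub_cancel, Nat.cast_succ, add_smul, one_smul, sub_sub]

end CompatSL2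

/-- **Proposition (Huybrechts, Prop. 1.5).** For a compatible deformation with
`L_ε = L + εv`, the variation `φ̃ : LʲP^{n−2j} → ⊕_{i≠j} LⁱP^{n−2i}` of the subspace
`LʲP^{n−2j} ⊂ Aⁿ` (the projection of `φ` onto the complementary summands of the primitive
decomposition) is given by
`φ̃(Lʲ(α)) = (N−n+j+1) L^{j+1} Q²_v(α) − j L^{j−1} Q⁰_v(α)`;
i.e. `φ(Lʲ(α))` differs from this value by an element `Lʲ(γ)` with `γ ∈ P^{n−2j}`. -/
theorem variation_of_primitive_summand
    (N : ℕ) (A : Type) [Ring A] [Algebra ℂ A] [FiniteDimensional ℂ A]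
    (𝒜 : ℤ → Submodule ℂ A) [GradedAlgebra 𝒜]
    (hbound : ∀ n : ℤ, (n < 0 ∨ 2 * (N : ℤ) < n) → 𝒜 n = ⊥)
    (hgc : ∀ (p q : ℤ), ∀ x ∈ 𝒜 p, ∀ y ∈ 𝒜 q, x * y = ((-1 : ℂ) ^ (p * q)) • (y * x))
    (S : CompatSL2 N A 𝒜)
    (φ : Module.End ℂ A) (v : A) (hv : v ∈ 𝒜 2)
    (hφ0 : ∀ (n : ℤ), ∀ x ∈ 𝒜 n, φ x ∈ 𝒜 n)
    (hφL : S.L * φ - φ * S.L = LinearMap.mulRight ℂ v)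
    (n : ℤ) (j : ℕ)
    (α : A) (hαm : α ∈ 𝒜 (n - 2 * (j : ℤ))) (hαp : S.Lam α = 0)
    (q0 q1 q2 : A)
    (hq0 : q0 ∈ 𝒜 (n - 2 * (j : ℤ) + 2)) (hq1 : q1 ∈ 𝒜 (n - 2 * (j : ℤ))) (hq2 : q2 ∈ 𝒜 (n - 2 * (j : ℤ) - 2))
    (hq0p : S.Lam q0 = 0) (hq1p : S.Lam q1 = 0) (hq2p : S.Lam q2 = 0)
    (hqdec : α * v = q0 + S.L q1 + (S.L ^ 2) q2)
    :
    ∃ γ : A, γ ∈ 𝒜 (n - 2 * (j : ℤ)) ∧ S.Lam γ = 0 ∧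
      φ ((S.L ^ j) α) =
        (S.L ^ j) γ
        + ((N : ℂ) - (n : ℂ) + (j : ℂ) + 1) • (S.L ^ (j + 1)) q2
        - (j : ℂ) • (S.L ^ (j - 1)) q0 := by
  rcases le_or_gt (n - 2 * (j : ℤ)) N with hm | hm
  · obtain ⟨s, hs⟩ := Int.le.dest hm
    have hsC : (N : ℂ) = n - 2 * j + s := by
      exact_mod_cast hs.symm
    have decomp : ∀ k : ℕ, (S.L ^ k) (α * v) =
        (S.L ^ k) q0 + (S.L ^ (k + 1)) q1 + (S.L ^ (k + 2)) q2 := fun k => by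
      rw [hqdec, map_add, map_add, pow_add S.L k 2, pow_succ]
      rfl
    have hL2 : ∀ k : ℕ, (S.L ^ k) (S.L q2) = (S.L ^ (k + 1)) q2 := fun k => by
      rw [pow_succ]
      rfl
    have hLq2 : S.L q2 ∈ 𝒜 (n - 2 * (j : ℤ)) := by
      simpa using S.L_deg _ _ hq2
    have hprim : S.Lam (φ α - ((s : ℂ) + 1) • S.L q2) = 0 := by
      refine S.Lam_eq_zero_of_L_pow_eq_zero hbound
        (sub_mem (hφ0 _ α hαm) (Submodule.smul_mem _ _ hLq2)) hs ?_
      have h := S.apply_L_pow hφL (s + 1) α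
      rw [S.L_pow_primitive_eq_zero hbound hαm hαp (by push_cast; omega), map_zero,
        Nat.add_sub_cancel, decomp, S.L_pow_primitive_eq_zero hbound hq0 hq0p (by omega),
        S.L_pow_primitive_eq_zero hbound hq1 hq1p (by push_cast; omega), zero_add, zero_add] at h
      rw [map_sub, map_smul, hL2, h]
      push_cast
      rfl
    refine ⟨φ α - ((s : ℂ) + 1) • S.L q2 - (j : ℂ) • q1,
      sub_mem (sub_mem (hφ0 _ α hαm) (Submodule.smul_mem _ _ hLq2))
        (Submodule.smul_mem _ _ hq1), ?_, ?_⟩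
    · rw [map_sub, hprim, map_smul, hq1p, smul_zero, sub_zero]
    · rw [S.apply_L_pow hφL, map_sub, map_sub, map_smul, map_smul, hL2, hsC]
      cases j with
      | zero =>
        simp
      | succ j =>
        rw [Nat.add_sub_cancel, decomp]
        push_cast
        module
  · have hα : α = 0 := S.L_pow_primitive_eq_zero hbound hαm hαp (r := 0) (by simpa using hm)
    have hq0z : q0 = 0 :=
      S.L_pow_primitive_eq_zero hbound hq0 hq0p (r := 0) (by push_cast; omega)
    have hq1z : q1 = 0 := S.L_pow_primitive_eq_zero hbound hq1 hq1p (r := 0) (by simpa using hm)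
    have hq2z : ((N : ℂ) - n + j + 1) • (S.L ^ (j + 1)) q2 = 0 := by
      rcases eq_or_ne (n - 2 * (j : ℤ)) (N + 1) with hN | hN
      · cases j with
        | zero =>
          have : (n : ℂ) = N + 1 := by
            have : n = (N : ℤ) + 1 := by simpa using hN
            rw [this]
            push_cast
            rfl
          rw [this]
          simp
        | succ j =>
          rw [S.L_pow_primitive_eq_zero hbound hq2 hq2p (by push_cast at hN ⊢; omega), smul_zero]
      · rw [S.L_pow_primitive_eq_zero hbound hq2 hq2p (by push_cast; omega), smul_zero]
    refine ⟨0, zero_mem _, map_zero _, ?_⟩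
    rw [hq2z, hα, hq0z]
    simp
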